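/- arXiv:1611.05988 — 3 statements merged into one kernel-verified Lean document; each statement's English description precedes it below -/
import Mathlib

section
/- Any tree T, viewed as a metric space on its vertex set with the shortest path metric, has asymptotic dimension at most 1: for every R > 0 there exist two uniformly bounded R-disjoint families U_0, U_1 of subsets of T whose union covers T. -/
open scoped ENNReal
open Filter Set

noncomputable section

/-- Distance between two sets with respect to a distance function `d`,
as the infimum in `ℝ≥0∞` (so `⊤` if either set is empty). -/
def setDistD {α : Type*} (d : α → α → ℝ) (A B : Set α) : ℝ≥0∞ :=
  ⨅ (a) (_ : a ∈ A) (b) (_ : b ∈ B), ENNReal.ofReal (d a b)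

/-- A family of subsets is `R`-disjoint if any two distinct members are
at distance `> R`. -/
def RDisjointD {α : Type*} (d : α → α → ℝ) (R : ℝ) (𝒰 : Set (Set α)) : Prop :=
  ∀ A ∈ 𝒰, ∀ B ∈ 𝒰, A ≠ B → ENNReal.ofReal R < setDistD d A B

/-- Every member of the family has diameter at most `D`. -/
def MeshLE {α : Type*} (d : α → α → ℝ) (D : ℝ) (𝒰 : Set (Set α)) : Prop :=
  ∀ A ∈ 𝒰, ∀ x ∈ A, ∀ y ∈ A, d x y ≤ D

/-- A family is uniformly bounded if the diameters of its members have a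
common finite bound. -/
def UBoundedD {α : Type*} (d : α → α → ℝ) (𝒰 : Set (Set α)) : Prop :=
  ∃ D : ℝ, MeshLE d D 𝒰

/-- The family covers the whole space. -/
def CoversD {α : Type*} (𝒰 : Set (Set α)) : Prop := ∀ x : α, ∃ A ∈ 𝒰, x ∈ A

/-- Asymptotic property C for a space with distance function `d`: for every
nondecreasing sequence `R₀ ≤ R₁ ≤ ⋯` of positive reals there are `n` and
uniformly bounded `R i`-disjoint families `𝒰 i`, `i = 0, …, n`, whose union
covers the space. -/
def APCD {α : Type*} (d : α → α → ℝ) : Prop :=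
  ∀ R : ℕ → ℝ, (∀ i, 0 < R i) → Monotone R →
    ∃ (n : ℕ) (𝒰 : ℕ → Set (Set α)),
      (∀ i ≤ n, RDisjointD d (R i) (𝒰 i) ∧ UBoundedD d (𝒰 i)) ∧
      CoversD (⋃ i ≤ n, 𝒰 i)

/-- `f` is a coarse embedding: there are nondecreasing functions
`ρ₋, ρ₊` tending to `∞` with `ρ₋(d(x,y)) ≤ d(f x, f y) ≤ ρ₊(d(x,y))`. -/
def IsCoarseEmbeddingD {α β : Type*} (dα : α → α → ℝ) (dβ : β → β → ℝ)
    (f : α → β) : Prop :=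
  ∃ ρm ρp : ℝ → ℝ, Monotone ρm ∧ Monotone ρp ∧
    Tendsto ρm atTop atTop ∧ Tendsto ρp atTop atTop ∧
    ∀ x y, ρm (dα x y) ≤ dβ (f x) (f y) ∧ dβ (f x) (f y) ≤ ρp (dα x y)

/-- The shortest-path distance of a graph, as a real number. -/
def gdist {V : Type*} (G : SimpleGraph V) (x y : V) : ℝ := G.dist x y

/-- A subset `U` is `(N, R)`-large scale doubling: for every center `x` and
every `r ≥ R`, the set `B_{2r}(x) ∩ U` can be covered by `N` balls of
radius `r` with centers in the space. -/
def LSDoubling {α : Type*} (d : α → α → ℝ) (N : ℕ) (R : ℝ) (U : Set α) : Prop :=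
  ∀ x : α, ∀ r : ℝ, R ≤ r →
    ∃ c : Fin N → α, {y | d x y < 2 * r} ∩ U ⊆ ⋃ j, {y | d (c j) y ≤ r}

/-- A family is uniformly large scale doubling: there is `(N, R)` making every
member `(N, R)`-large scale doubling and every finite union of members
`(N, R')`-large scale doubling for some `R' > 0`. -/
def ULSDoubling {α : Type*} (d : α → α → ℝ) (𝒰 : Set (Set α)) : Prop :=
  ∃ (N : ℕ) (R : ℝ), (∀ U ∈ 𝒰, LSDoubling d N R U) ∧
    ∀ 𝒱 ⊆ 𝒰, 𝒱.Finite → ∃ R' > 0, LSDoubling d N R' (⋃₀ 𝒱)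

/-- A family is weakly uniformly large scale doubling: there is `(N, R)`
making every member `(N, R)`-large scale doubling. -/
def WULSDoubling {α : Type*} (d : α → α → ℝ) (𝒰 : Set (Set α)) : Prop :=
  ∃ (N : ℕ) (R : ℝ), ∀ U ∈ 𝒰, LSDoubling d N R U

/-- Hyperbolic property C: for every sequence of positive reals `R i` there
are `n` and `R i`-disjoint families whose union is a uniformly large scale
doubling cover of the space. -/
def HPCD {α : Type*} (d : α → α → ℝ) : Prop :=
  ∀ R : ℕ → ℝ, (∀ i, 0 < R i) →
    ∃ (n : ℕ) (𝒰 : ℕ → Set (Set α)),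
      (∀ i ≤ n, RDisjointD d (R i) (𝒰 i)) ∧
      CoversD (⋃ i ≤ n, 𝒰 i) ∧ ULSDoubling d (⋃ i ≤ n, 𝒰 i)

/-- Weak hyperbolic property C. -/
def WHPCD {α : Type*} (d : α → α → ℝ) : Prop :=
  ∀ R : ℕ → ℝ, (∀ i, 0 < R i) →
    ∃ (n : ℕ) (𝒰 : ℕ → Set (Set α)),
      (∀ i ≤ n, RDisjointD d (R i) (𝒰 i)) ∧
      CoversD (⋃ i ≤ n, 𝒰 i) ∧ WULSDoubling d (⋃ i ≤ n, 𝒰 i)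

/-- `𝒳` is `R`-decomposable over `𝒴`: every member of `𝒳` is covered by the
union of two `R`-disjoint families contained in `𝒴`. -/
def DecompD {α : Type*} (d : α → α → ℝ) (R : ℝ) (𝒳 𝒴 : Set (Set α)) : Prop :=
  ∀ X ∈ 𝒳, ∃ 𝒰₁ 𝒰₂ : Set (Set α), RDisjointD d R 𝒰₁ ∧ RDisjointD d R 𝒰₂ ∧
    𝒰₁ ∪ 𝒰₂ ⊆ 𝒴 ∧ X ⊆ ⋃₀ (𝒰₁ ∪ 𝒰₂)

/-- Straight finite decomposition complexity of a metric family `𝒳` (of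
subsets of an ambient space): for every nondecreasing sequence of positive
reals there is a finite chain of decompositions ending in a uniformly
bounded family. -/
def SFDCD {α : Type*} (d : α → α → ℝ) (𝒳 : Set (Set α)) : Prop :=
  ∀ R : ℕ → ℝ, (∀ i, 0 < R i) → Monotone R →
    ∃ (n : ℕ) (𝒱 : ℕ → Set (Set α)),
      DecompD d (R 0) 𝒳 (𝒱 0) ∧
      (∀ i < n, DecompD d (R (i + 1)) (𝒱 i) (𝒱 (i + 1))) ∧
      UBoundedD d (𝒱 n)

/-- `asdim ≤ n` for a single space: for every `R > 0` there are `n + 1`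
uniformly bounded `R`-disjoint families covering the space. -/
def AsdimLE {α : Type*} (d : α → α → ℝ) (n : ℕ) : Prop :=
  ∀ R : ℝ, 0 < R → ∃ 𝒰 : Fin (n + 1) → Set (Set α),
    (∀ i, RDisjointD d R (𝒰 i) ∧ UBoundedD d (𝒰 i)) ∧
    CoversD (⋃ i, 𝒰 i)

/-- `asdim {X_α} ≤ n` uniformly for a family of subsets of an ambient space:
for every `R > 0` there is `D` such that every member is covered by `n + 1`
`R`-disjoint families of its subsets of mesh at most `D`. -/
def AsdimFamLE {α : Type*} (d : α → α → ℝ) (𝒳 : Set (Set α)) (n : ℕ) : Prop :=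
  ∀ R : ℝ, 0 < R → ∃ D : ℝ, 0 ≤ D ∧
    ∀ X ∈ 𝒳, ∃ 𝒰 : Fin (n + 1) → Set (Set α),
      (∀ i, RDisjointD d R (𝒰 i) ∧ MeshLE d D (𝒰 i) ∧ ∀ A ∈ 𝒰 i, A ⊆ X) ∧
      ∀ x ∈ X, ∃ i, ∃ A ∈ 𝒰 i, x ∈ A

/-- The metric `d((a_i),(b_i)) = Σᵢ (i+1)·dᵢ(aᵢ,bᵢ)` on a (restricted)
product, indexing coordinates by `0, 1, 2, …` with weights `1, 2, 3, …`. -/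
def dRP {V : ℕ → Type*} (d : ∀ i, V i → V i → ℝ) (a b : ∀ i, V i) : ℝ :=
  ∑' i : ℕ, ((i : ℝ) + 1) * d i (a i) (b i)

/-- A rooted tree has a parent function. -/
theorem tree_exists_parent {V : Type*} (G : SimpleGraph V) (hG : G.IsTree) (r : V) :
    ∃ p : V → V, (∀ v, G.dist v (p v) ≤ 1) ∧
      ∀ u v, G.Adj u v → G.dist u r = G.dist v r + 1 → p u = v := by
  have hc : G.Connected := hG.1
  choose w hw using fun v => hc.exists_walk_length_eq_dist v r
  refine ⟨fun v => (w v).snd, ?_, ?_⟩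
  · intro v
    by_cases hn : (w v).Nil
    · have : (w v).snd = v := by
        have h0 : (w v).length = 0 := SimpleGraph.Walk.nil_iff_length_eq.mp hn
        have := (w v).getVert_of_length_le (i := 1) (by omega)
        exact this.trans hn.eq.symm
      simp [this]
    · have := (w v).adj_snd hn
      exact (SimpleGraph.dist_eq_one_iff_adj.mpr this).le
  · intro u v huv h
    have h1 : (SimpleGraph.Walk.cons huv (w v)).length = G.dist u r := by
      simp [hw, h]
    have e := hG.2.path_unique ⟨_, (w u).isPath_of_length_eq_dist (hw u)⟩
      ⟨_, SimpleGraph.Walk.isPath_of_length_eq_dist _ h1⟩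
    have e' : w u = SimpleGraph.Walk.cons huv (w v) := congrArg Subtype.val e
    simp [e']

/-- Nearby vertices have the same ancestor at a much lower depth. -/
theorem tree_anc_eq {V : Type*} (G : SimpleGraph V) (hG : G.IsTree) (r : V) (p : V → V)
    (hp : ∀ u v, G.Adj u v → G.dist u r = G.dist v r + 1 → p u = v) (m : ℕ)
    {x y : V} (w : G.Walk x y) (hm : m ≤ G.dist x r - w.length) :
    p^[G.dist x r - m] x = p^[G.dist y r - m] y := by
  induction w with
  | nil => rfl
  | @cons u v z huv w ih =>
    simp only [SimpleGraph.Walk.length_cons] at hm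
    have hd := hG.dist_eq_dist_add_one_of_adj r huv
    rw [SimpleGraph.dist_comm (u := r) (v := u), SimpleGraph.dist_comm (u := r) (v := v)] at hd
    have := ih (by omega)
    rw [← this]
    rcases hd with hd | hd
    · rw [show G.dist u r - m = (G.dist v r - m) + 1 by omega, Function.iterate_succ_apply,
        hp u v huv hd]
    · rw [show G.dist v r - m = (G.dist u r - m) + 1 by omega, Function.iterate_succ_apply,
        hp v u huv.symm hd]

theorem tree_dist_iterate {V : Type*} (G : SimpleGraph V) (hc : G.Connected) (p : V → V)
    (hp : ∀ v, G.dist v (p v) ≤ 1) (n : ℕ) (v : V) : G.dist v (p^[n] v) ≤ n := by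
  induction n with
  | zero => simp
  | succ n ih =>
    rw [Function.iterate_succ_apply']
    have := hc.dist_triangle (u := v) (v := p^[n] v) (w := p (p^[n] v))
    have := hp (p^[n] v)
    omega

/-- any tree, with the shortest path metric on its vertices,
has asymptotic dimension at most 1. -/
theorem tree_asdim_le_one {V : Type*} (G : SimpleGraph V) (hG : G.IsTree) :
    AsdimLE (gdist G) 1 := by
  intro R hR
  obtain ⟨r⟩ := hG.1.nonempty
  have hc : G.Connected := hG.1
  obtain ⟨p, hp1, hp2⟩ := tree_exists_parent G hG r
  obtain ⟨N, hN⟩ := exists_nat_ge R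
  have hN0 : 0 < N := by
    have : (0 : ℝ) < N := hR.trans_le hN
    exact_mod_cast this
  let S : ℕ → V → Set V := fun k a =>
    {v | G.dist v r / N = k ∧ p^[G.dist v r - (N * k - N)] v = a}
  refine ⟨fun i => {A | ∃ k a, k % 2 = i.val ∧ A = S k a}, ?_, ?_⟩
  · intro i
    constructor
    · rintro _ ⟨k, a, hk, rfl⟩ _ ⟨l, b, hl, rfl⟩ hne
      have key : ∀ x ∈ S k a, ∀ y ∈ S l b, N + 1 ≤ G.dist x y := by
        rintro x ⟨hx, hxa⟩ y ⟨hy, hyb⟩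
        by_contra hlt
        have hle : G.dist x y ≤ N := by omega
        apply hne
        have t1 := hc.dist_triangle (u := x) (v := y) (w := r)
        have t2 := hc.dist_triangle (u := y) (v := x) (w := r)
        rw [SimpleGraph.dist_comm (u := y) (v := x)] at t2
        have k1 : k ≤ l + 1 := by
          rw [← hx, ← hy, ← Nat.add_div_right _ hN0]
          exact Nat.div_le_div_right (by omega)
        have k2 : l ≤ k + 1 := by
          rw [← hx, ← hy, ← Nat.add_div_right _ hN0]
          exact Nat.div_le_div_right (by omega)
        have hkl : k = l := by omega
        subst hkl
        obtain ⟨w, hw⟩ := hc.exists_walk_length_eq_dist x y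
        have hNk : N * k ≤ G.dist x r := by
          rw [← hx]; exact Nat.mul_div_le _ _
        have := tree_anc_eq G hG r p hp2 (N * k - N) w (by omega)
        rw [← hxa, ← hyb, this]
      have hlt : ENNReal.ofReal R < ENNReal.ofReal ((N : ℝ) + 1) :=
        (ENNReal.ofReal_lt_ofReal_iff (by positivity)).mpr (by linarith)
      refine hlt.trans_le ?_
      refine le_iInf fun x => le_iInf fun hx => le_iInf fun y => le_iInf fun hy => ?_
      apply ENNReal.ofReal_le_ofReal
      have := key x hx y hy
      unfold gdist
      exact_mod_cast this
    · refine ⟨((4 * N : ℕ) : ℝ), ?_⟩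
      rintro _ ⟨k, a, hk, rfl⟩ x ⟨hx, hxa⟩ y ⟨hy, hyb⟩
      have bd : ∀ v, G.dist v r / N = k → G.dist v r - (N * k - N) ≤ 2 * N := by
        intro v hv
        have h1 := Nat.div_add_mod (G.dist v r) N
        have h2 := Nat.mod_lt (G.dist v r) hN0
        rw [hv] at h1
        omega
      have d1 := tree_dist_iterate G hc p hp1 (G.dist x r - (N * k - N)) x
      have d2 := tree_dist_iterate G hc p hp1 (G.dist y r - (N * k - N)) y
      rw [hxa] at d1
      rw [hyb, SimpleGraph.dist_comm] at d2
      have b1 := bd x hx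
      have b2 := bd y hy
      have t := hc.dist_triangle (u := x) (v := a) (w := y)
      unfold gdist
      exact_mod_cast (show G.dist x y ≤ 4 * N by omega)
  · intro x
    refine ⟨S (G.dist x r / N) _, Set.mem_iUnion.mpr
      ⟨⟨G.dist x r / N % 2, Nat.mod_lt _ (by norm_num)⟩, _, _, rfl, rfl⟩, rfl, rfl⟩
end
end

section
/- If (T_i)_{i=1}^∞ is a sequence of trees (each with a chosen base vertex), then the restricted product ×_{i=1}^∞ T_i, equipped with the metric d((a_i),(b_i)) = Σ_{i=1}^∞ i·d(a_i,b_i), has asymptotic property C. -/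
open scoped ENNReal
open Filter Set

noncomputable section

section TreeLemmas

variable {V : Type*} {G : SimpleGraph V}

/-- In a tree, the neighbour closer to the root is unique. -/
lemma tree_parent_unique (hG : G.IsTree) (o : V) {v w w' : V}
    (h1 : G.Adj w v) (h2 : G.Adj w' v) (d1 : G.dist o v = G.dist o w + 1)
    (d2 : G.dist o v = G.dist o w' + 1) : w = w' := by
  obtain ⟨p, hp⟩ := hG.connected.exists_walk_length_eq_dist o w
  obtain ⟨p', hp'⟩ := hG.connected.exists_walk_length_eq_dist o w'
  have hP : (p.concat h1).IsPath := by
    apply SimpleGraph.Walk.isPath_of_length_eq_dist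
    rw [SimpleGraph.Walk.length_concat, hp, d1]
  have hP' : (p'.concat h2).IsPath := by
    apply SimpleGraph.Walk.isPath_of_length_eq_dist
    rw [SimpleGraph.Walk.length_concat, hp', d2]
  have := (hG.existsUnique_path o v).unique hP hP'
  have h3 := congrArg SimpleGraph.Walk.penultimate this
  simpa [SimpleGraph.Walk.penultimate_concat] using h3

lemma tree_exists_parent_s5 (hG : G.IsTree) (o v : V) (hv : 0 < G.dist o v) :
    ∃ w, G.Adj w v ∧ G.dist o v = G.dist o w + 1 := by
  obtain ⟨p, hp⟩ := hG.connected.exists_walk_length_eq_dist v o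
  rw [SimpleGraph.dist_comm] at hp
  cases p with
  | nil => simp at hv
  | cons h q =>
    rename_i w
    refine ⟨w, h.symm, ?_⟩
    rw [SimpleGraph.Walk.length_cons] at hp
    have h1 : G.dist w o ≤ q.length := SimpleGraph.dist_le q
    rw [SimpleGraph.dist_comm] at h1
    have h2 : G.dist o v ≤ G.dist o w + G.dist w v := hG.connected.dist_triangle
    have h3 : G.dist w v = 1 := SimpleGraph.dist_eq_one_iff_adj.2 h.symm
    omega

/-- Ancestor functions of a rooted tree. -/
lemma tree_exists_anc (hG : G.IsTree) (o : V) :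
    ∃ anc : ℕ → V → V, (∀ l v, G.dist v (anc l v) ≤ G.dist o v - l) ∧
      ∀ l v w, G.Adj v w → l ≤ G.dist o v → l ≤ G.dist o w → anc l v = anc l w := by
  classical
  have hpar : ∀ v, ∃ w, 0 < G.dist o v → G.Adj w v ∧ G.dist o v = G.dist o w + 1 := by
    intro v
    by_cases hv : 0 < G.dist o v
    · obtain ⟨w, hw⟩ := tree_exists_parent_s5 hG o v hv
      exact ⟨w, fun _ => hw⟩
    · exact ⟨v, fun h => absurd h hv⟩
  choose par hpar using hpar
  have key : ∀ l v w, G.dist o w = G.dist o v + 1 → G.Adj v w → l ≤ G.dist o v →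
      par^[G.dist o v - l] v = par^[G.dist o w - l] w := by
    intro l v w hd ha hl
    have hw := hpar w (by omega)
    have : par w = v := tree_parent_unique hG o hw.1 ha hw.2 hd
    rw [show G.dist o w - l = (G.dist o v - l) + 1 by omega, Function.iterate_succ_apply, this]
  refine ⟨fun l v => par^[G.dist o v - l] v, ?_, ?_⟩
  · have aux : ∀ j v, j ≤ G.dist o v → G.dist v (par^[j] v) ≤ j := by
      intro j
      induction j with
      | zero => intro v _; simp
      | succ j ih =>
        intro v hv
        have hw := hpar v (by omega)
        have h1 := ih (par v) (by omega)
        rw [Function.iterate_succ_apply]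
        have h2 : G.dist v (par^[j] (par v)) ≤ G.dist v (par v) + G.dist (par v) (par^[j] (par v)) :=
          hG.connected.dist_triangle
        have h3 : G.dist v (par v) = 1 := SimpleGraph.dist_eq_one_iff_adj.2 hw.1.symm
        omega
    intro l v
    exact aux _ _ (Nat.sub_le _ _)
  · intro l v w ha hv hw
    have h0 := hG.dist_ne_of_adj o ha
    have h1 : G.dist v w = 1 := SimpleGraph.dist_eq_one_iff_adj.2 ha
    have h2 : G.dist o w ≤ G.dist o v + G.dist v w := hG.connected.dist_triangle
    have h3 : G.dist o v ≤ G.dist o w + G.dist w v := hG.connected.dist_triangle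
    rw [SimpleGraph.dist_comm (u := w)] at h3
    rcases Nat.lt_or_gt_of_ne h0 with h | h
    · exact key l v w (by omega) ha hv
    · exact (key l w v (by omega) ha.symm hw).symm

lemma tree_label (hG : G.IsTree) (o : V) (r L : ℕ) (P : ℕ → Prop) (β : ℕ → ℕ)
    (h1 : ∀ h, β h ≤ h) (h2 : ∀ h, h ≤ β h + L)
    (h3 : ∀ h h', P h → P h' → h ≤ h' + r → h' ≤ h + r → β h = β h') :
    ∃ f : V → ℕ × V,
      (∀ v w, P (G.dist o v) → P (G.dist o w) → G.dist v w ≤ r → f v = f w) ∧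
      ∀ v w, f v = f w → G.dist v w ≤ 2 * (L + r) := by
  obtain ⟨anc, ha, hb⟩ := tree_exists_anc hG o
  have walk : ∀ (l : ℕ) (v w : V) (p : G.Walk v w), l ≤ G.dist o v - p.length →
      anc l v = anc l w := by
    intro l v w p
    induction p with
    | nil => intro _; rfl
    | cons h q ih =>
      rename_i a b c
      intro hl
      rw [SimpleGraph.Walk.length_cons] at hl
      have t1 : G.dist a b = 1 := SimpleGraph.dist_eq_one_iff_adj.2 h
      have t2 : G.dist o a ≤ G.dist o b + G.dist b a := hG.connected.dist_triangle
      rw [SimpleGraph.dist_comm (u := b)] at t2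
      rw [hb l a b h (by omega) (by omega)]
      exact ih (by omega)
  refine ⟨fun v => (β (G.dist o v), anc (β (G.dist o v) - r) v), ?_, ?_⟩
  · intro v w hv hw hd
    have t2 : G.dist o w ≤ G.dist o v + G.dist v w := hG.connected.dist_triangle
    have t3 : G.dist o v ≤ G.dist o w + G.dist w v := hG.connected.dist_triangle
    rw [SimpleGraph.dist_comm (u := w)] at t3
    have e := h3 _ _ hv hw (by omega) (by omega)
    simp only [← e, Prod.mk.injEq, true_and]
    obtain ⟨p, hp⟩ := hG.connected.exists_walk_length_eq_dist v w
    apply walk _ _ _ p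
    have := h1 (G.dist o v)
    omega
  · intro v w h
    simp only [Prod.mk.injEq] at h
    obtain ⟨e1, e2⟩ := h
    have a1 := ha (β (G.dist o v) - r) v
    have a2 := ha (β (G.dist o w) - r) w
    rw [← e2] at a2
    have t : G.dist v w ≤ G.dist v (anc (β (G.dist o v) - r) v) +
      G.dist (anc (β (G.dist o v) - r) v) w := hG.connected.dist_triangle
    rw [SimpleGraph.dist_comm (u := anc (β (G.dist o v) - r) v)] at t
    have := h2 (G.dist o v)
    have := h2 (G.dist o w)
    omega

lemma tree_all (hG : G.IsTree) (o : V) (r m : ℕ) (hm : 0 < m) :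
    ∃ (e : V → Bool) (p : V → ℕ × V) (I : ℕ → V → Prop) (q : ℕ → V → ℕ × V),
      (∀ v w, e v = e w → G.dist v w ≤ r → p v = p w) ∧
      (∀ v w, e v = e w → p v = p w → G.dist v w ≤ 2 * (2 * m * (r + 1) + r)) ∧
      (∀ s < m, ∀ s' < m, ∀ v w, I s v → I s' w → G.dist v w ≤ r → s = s') ∧
      (∀ s < m, ∀ v w, ¬ I s v → ¬ I s w → G.dist v w ≤ r → q s v = q s w) ∧
      (∀ s < m, ∀ v w, q s v = q s w → G.dist v w ≤ 2 * (2 * m * (r + 1) + r)) := by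
  have blk : ∀ h h', h ≤ h' + r → h' ≤ h + r →
      h / (r + 1) ≤ h' / (r + 1) + 1 ∧ h' / (r + 1) ≤ h / (r + 1) + 1 := by
    intro h h' a b
    rw [← Nat.add_div_right _ (Nat.succ_pos r), ← Nat.add_div_right _ (Nat.succ_pos r)]
    exact ⟨Nat.div_le_div_right (by omega), Nat.div_le_div_right (by omega)⟩
  have hdiv : ∀ h, h / (r + 1) * (r + 1) ≤ h ∧ h ≤ h / (r + 1) * (r + 1) + r := by
    intro h
    have := Nat.div_add_mod h (r + 1)
    have : h % (r + 1) < r + 1 := Nat.mod_lt h (Nat.succ_pos r)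
    rw [mul_comm]
    constructor <;> omega
  have T : ∀ ε : Bool, _ := fun ε => tree_label hG o r r
    (fun h => decide (h / (r + 1) % 2 = 0) = ε) (fun h => h / (r + 1) * (r + 1))
    (fun h => (hdiv h).1) (fun h => (hdiv h).2) (by
      intro h h' a b c d
      have := blk h h' c d
      have e : h / (r + 1) = h' / (r + 1) := by
        rw [← b, decide_eq_decide] at a
        omega
      simp only [e])
  choose p hp1 hp2 using T
  have hq : ∀ s, ∃ q : V → ℕ × V, s < m →
      (∀ v w, ¬ (G.dist o v / (r + 1) % (2 * m) = 2 * s) →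
        ¬ (G.dist o w / (r + 1) % (2 * m) = 2 * s) → G.dist v w ≤ r → q v = q w) ∧
      (∀ v w, q v = q w → G.dist v w ≤ 2 * (2 * m * (r + 1) + r)) := by
    intro s
    by_cases hs : s < m
    swap
    · exact ⟨fun v => (0, v), fun h => absurd h hs⟩
    obtain ⟨q, hq⟩ := tree_label hG o r (2 * m * (r + 1))
      (fun h => ¬ (h / (r + 1) % (2 * m) = 2 * s))
      (fun h => ((h / (r + 1) + (2 * m - 2 * s)) / (2 * m) * (2 * m) - (2 * m - 2 * s)) * (r + 1))
      (by
        intro h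
        refine le_trans (Nat.mul_le_mul_right _ ?_) (hdiv h).1
        have := Nat.div_mul_le_self (h / (r + 1) + (2 * m - 2 * s)) (2 * m)
        generalize h / (r + 1) = z at *
        omega)
      (by
        intro h
        have h1 := (hdiv h).2
        set x := h / (r + 1) with hx
        set y := (x + (2 * m - 2 * s)) / (2 * m) * (2 * m) with hy
        have h2 : x + (2 * m - 2 * s) < y + 2 * m := by
          have := Nat.div_add_mod (x + (2 * m - 2 * s)) (2 * m)
          have := Nat.mod_lt (x + (2 * m - 2 * s)) (show 2 * m > 0 by omega)
          rw [mul_comm] at hy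
          omega
        have h3 : x + 1 ≤ (y - (2 * m - 2 * s)) + 2 * m := by omega
        have h4 := Nat.mul_le_mul_right (r + 1) h3
        rw [add_mul, add_mul] at h4
        omega)
      (by
        intro h h' a b c d
        have hb := blk h h' c d
        set x := h / (r + 1) with hx
        set x' := h' / (r + 1) with hx'
        have key : ∀ z, ¬ ((z + 1) % (2 * m) = 2 * s) →
            (z + 1 + (2 * m - 2 * s)) / (2 * m) = (z + (2 * m - 2 * s)) / (2 * m) := by
          intro z hz
          rw [show z + 1 + (2 * m - 2 * s) = (z + (2 * m - 2 * s)) + 1 by omega, Nat.succ_div,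
            if_neg, add_zero]
          intro hd
          apply hz
          obtain ⟨t, ht⟩ := hd
          have ht0 : 1 ≤ t := by
            rcases Nat.eq_zero_or_pos t with h | h
            · subst h; omega
            · exact h
          obtain ⟨t', rfl⟩ := Nat.exists_eq_add_of_le ht0
          have : z + 1 = 2 * s + 2 * m * t' := by
            rw [mul_add] at ht
            omega
          rw [this, Nat.add_mul_mod_self_left, Nat.mod_eq_of_lt (by omega)]
        have : (x + (2 * m - 2 * s)) / (2 * m) = (x' + (2 * m - 2 * s)) / (2 * m) := by
          rcases (show x = x' ∨ x = x' + 1 ∨ x' = x + 1 by omega) with h | h | h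
          · rw [h]
          · rw [h]; exact key x' (by rw [← h]; exact a)
          · rw [h]; exact (key x (by rw [← h]; exact b)).symm
        simp only [this])
    exact ⟨q, fun _ => hq⟩
  choose q hq using hq
  refine ⟨fun v => decide (G.dist o v / (r + 1) % 2 = 0),
    fun v => p (decide (G.dist o v / (r + 1) % 2 = 0)) v,
    fun s v => G.dist o v / (r + 1) % (2 * m) = 2 * s, q, ?_, ?_, ?_,
    fun s hs => (hq s hs).1, fun s hs => (hq s hs).2⟩
  · intro v w he hd
    dsimp only at he ⊢
    rw [← he]
    exact hp1 _ v w rfl he.symm hd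
  · intro v w he hpe
    dsimp only at he hpe
    rw [← he] at hpe
    have h := hp2 _ v w hpe
    have : r + 1 ≤ 2 * m * (r + 1) := Nat.le_mul_of_pos_left _ (by omega)
    omega
  · intro s hs s' hs' v w hv hw hd
    have t2 : G.dist o w ≤ G.dist o v + G.dist v w := hG.connected.dist_triangle
    have t3 : G.dist o v ≤ G.dist o w + G.dist w v := hG.connected.dist_triangle
    rw [SimpleGraph.dist_comm (u := w)] at t3
    have hb := blk (G.dist o v) (G.dist o w) (by omega) (by omega)
    have e1 : G.dist o v / (r + 1) % 2 = 0 := by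
      rw [← Nat.mod_mul_right_mod _ 2 m, hv]; omega
    have e2 : G.dist o w / (r + 1) % 2 = 0 := by
      rw [← Nat.mod_mul_right_mod _ 2 m, hw]; omega
    have : G.dist o v / (r + 1) = G.dist o w / (r + 1) := by omega
    rw [this] at hv
    omega

end TreeLemmas

lemma family_of_label {α β : Type*} (d : α → α → ℝ) (R D : ℝ) (hR : 0 < R) (A : Set α)
    (f : α → β) (h1 : ∀ a ∈ A, ∀ b ∈ A, d a b ≤ R + 1 → f a = f b)
    (h2 : ∀ a ∈ A, ∀ b ∈ A, f a = f b → d a b ≤ D) :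
    ∃ 𝒰 : Set (Set α), RDisjointD d R 𝒰 ∧ UBoundedD d 𝒰 ∧ ∀ a ∈ A, ∃ U ∈ 𝒰, a ∈ U := by
  refine ⟨Set.range fun y => {a | a ∈ A ∧ f a = y}, ?_, ⟨D, ?_⟩, ?_⟩
  · rintro _ ⟨y, rfl⟩ _ ⟨z, rfl⟩ hne
    have hyz : y ≠ z := by rintro rfl; exact hne rfl
    refine lt_of_lt_of_le ((ENNReal.ofReal_lt_ofReal_iff (by linarith)).2 (lt_add_one R)) ?_
    refine le_iInf fun a => le_iInf fun ha => le_iInf fun b => le_iInf fun hb => ?_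
    apply ENNReal.ofReal_le_ofReal
    by_contra hlt
    exact hyz (ha.2.symm.trans ((h1 a ha.1 b hb.1 (not_le.1 hlt).le).trans hb.2))
  · rintro _ ⟨y, rfl⟩ a ha b hb
    exact h2 a ha.1 b hb.1 (ha.2.trans hb.2.symm)
  · intro a ha
    exact ⟨_, ⟨f a, rfl⟩, ha, rfl⟩

lemma dRP_coord {V : ℕ → Type*} (G : ∀ i, SimpleGraph (V i)) (x : ∀ i, V i)
    (a b : {a : ∀ i, V i // {i | a i ≠ x i}.Finite}) (i : ℕ) :
    ((i : ℝ) + 1) * ((G i).dist (a.1 i) (b.1 i) : ℝ) ≤ dRP (fun i => gdist (G i)) a.1 b.1 := by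
  unfold dRP gdist
  refine Summable.le_tsum (f := fun i : ℕ => ((i : ℝ) + 1) * ((G i).dist (a.1 i) (b.1 i) : ℝ))
    ?_ i (fun j _ => by positivity)
  apply summable_of_hasFiniteSupport
  refine (a.2.union b.2).subset ?_
  intro j hj
  by_contra hc
  simp only [Set.mem_union, Set.mem_ofPred_eq, not_or, not_not] at hc
  apply hj
  simp [hc.1, hc.2]

lemma dRP_le {V : ℕ → Type*} (G : ∀ i, SimpleGraph (V i)) (a b : ∀ i, V i) (N D : ℕ)
    (h1 : ∀ i < N, (G i).dist (a i) (b i) ≤ D) (h2 : ∀ i, N ≤ i → a i = b i) :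
    dRP (fun i => gdist (G i)) a b ≤ ∑ i ∈ Finset.range N, ((i : ℝ) + 1) * (D : ℝ) := by
  unfold dRP gdist
  rw [tsum_eq_sum (s := Finset.range N)]
  · refine Finset.sum_le_sum fun i hi => ?_
    have : ((G i).dist (a i) (b i) : ℝ) ≤ D := by exact_mod_cast h1 i (Finset.mem_range.1 hi)
    gcongr
  · intro i hi
    rw [h2 i (by simpa using hi)]
    simp

/-- the restricted product of a sequence of (pointed) trees,
with the metric `d((a_i),(b_i)) = Σ (i+1)·d(a_i,b_i)`, has asymptotic
property C. -/
theorem restricted_product_trees_apc {V : ℕ → Type*}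
    (G : ∀ i, SimpleGraph (V i)) (hG : ∀ i, (G i).IsTree)
    (x : ∀ i, V i) :
    APCD (α := {a : ∀ i, V i // {i | a i ≠ x i}.Finite})
      (fun a b => dRP (fun i => gdist (G i)) a.1 b.1) := by
  classical
  intro R hR0 hRm
  -- coordinates `≥ k` are invisible at scale `R 0 + 1`
  set k : ℕ := ⌈R 0 + 1⌉₊ with hk
  let C := Fin k × (Fin k → Bool)
  set n : ℕ := Fintype.card C with hn
  let enc : C ≃ Fin n := Fintype.equivFin C
  set N : ℕ := ⌈R n + 1⌉₊ with hN
  have hkN : k ≤ N := Nat.ceil_mono (by have := hRm (Nat.zero_le n); linarith)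
  set m : ℕ := Fintype.card (Fin N → Bool) with hm
  have hm0 : 0 < m := Fintype.card_pos
  let encS : (Fin N → Bool) ≃ Fin m := Fintype.equivFin _
  have T := fun i => tree_all (hG i) (x i) N m hm0
  choose e p I q hp1 hp2 hI hq1 hq2 using T
  set D : ℕ := 2 * (2 * m * (N + 1) + N) with hD
  let X := {a : ∀ i, V i // {i | a i ≠ x i}.Finite}
  let s : X → ℕ := fun a => encS fun i => if k ≤ (i : ℕ) then e i (a.1 i) else false
  have hs : ∀ a, s a < m := fun a => (encS _).2
  have hs_eq : ∀ a b : X, s a = s b → ∀ i, k ≤ i → i < N → e i (a.1 i) = e i (b.1 i) := by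
    intro a b h i h1 h2
    have h3 := congrFun (encS.injective (Fin.ext h)) ⟨i, h2⟩
    simpa [h1] using h3
  have hs_of : ∀ a b : X, (∀ i, k ≤ i → a.1 i = b.1 i) → s a = s b := by
    intro a b h
    have : (fun i : Fin N => if k ≤ (i : ℕ) then e i (a.1 i) else false) =
        (fun i : Fin N => if k ≤ (i : ℕ) then e i (b.1 i) else false) := by
      funext i
      split_ifs with hi
      · rw [h i hi]
      · rfl
    simp only [s, this]
  -- coordinates with large weights agree
  have hbig : ∀ (a b : X) (ρ : ℝ), dRP (fun i => gdist (G i)) a.1 b.1 ≤ ρ →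
      ∀ i, ⌈ρ⌉₊ ≤ i → a.1 i = b.1 i := by
    intro a b ρ h i hi
    have h1 := (dRP_coord G x a b i).trans h
    have h2 : ρ ≤ i := Nat.ceil_le.1 hi
    by_contra hne
    have h3 : 0 < (G i).dist (a.1 i) (b.1 i) := (hG i).connected.pos_dist_of_ne hne
    have h4 : (1 : ℝ) ≤ (G i).dist (a.1 i) (b.1 i) := by exact_mod_cast h3
    have h5 : (0 : ℝ) ≤ i := Nat.cast_nonneg i
    nlinarith
  have hsmall : ∀ (a b : X) (ρ : ℝ), dRP (fun i => gdist (G i)) a.1 b.1 ≤ ρ → ρ ≤ R n + 1 →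
      ∀ i, (G i).dist (a.1 i) (b.1 i) ≤ N := by
    intro a b ρ h hρ i
    have h1 := (dRP_coord G x a b i).trans (h.trans hρ)
    have h2 : R n + 1 ≤ N := Nat.le_ceil _
    have h5 : (0 : ℝ) ≤ i := Nat.cast_nonneg i
    have h6 : (0 : ℝ) ≤ (G i).dist (a.1 i) (b.1 i) := Nat.cast_nonneg _
    have : ((G i).dist (a.1 i) (b.1 i) : ℝ) ≤ N := by nlinarith
    exact_mod_cast this
  -- colour classes
  let A0 : Set X := {a | ∀ t < k, ¬ I t (s a) (a.1 t)}
  let A1 : C → Set X := fun c => {a | I c.1 (s a) (a.1 c.1) ∧ ∀ i : Fin k, e i (a.1 i) = c.2 i}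
  have fam0 := family_of_label (fun a b : X => dRP (fun i => gdist (G i)) a.1 b.1) (R 0)
    (∑ i ∈ Finset.range k, ((i : ℝ) + 1) * (D : ℝ)) (hR0 0) A0
    (fun a => ((fun i : Fin k => q i (s a) (a.1 i)), fun i : {i : ℕ // k ≤ i} => a.1 i.1))
    (by
      intro a ha b hb hd
      have h1 := hbig a b _ hd
      have h2 := hs_of a b h1
      refine Prod.ext ?_ ?_
      · funext i
        dsimp only
        rw [← h2]
        refine hq1 i (s a) (hs a) _ _ (ha i i.2) ?_ (hsmall a b _ hd ?_ i)
        · rw [h2]; exact hb i i.2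
        · have := hRm (Nat.zero_le n); linarith
      · funext i
        exact h1 i.1 i.2)
    (by
      intro a ha b hb h
      obtain ⟨h1, h2⟩ := Prod.ext_iff.1 h
      have h3 : ∀ i, k ≤ i → a.1 i = b.1 i := fun i hi => congrFun h2 ⟨i, hi⟩
      have h4 := hs_of a b h3
      refine dRP_le G a.1 b.1 k D (fun i hi => ?_) h3
      have h5 := congrFun h1 ⟨i, hi⟩
      dsimp only at h5
      rw [← h4] at h5
      exact hq2 i (s a) (hs a) _ _ h5)
  have fam1 : ∀ c : C, _ := fun c =>
    family_of_label (fun a b : X => dRP (fun i => gdist (G i)) a.1 b.1) (R n)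
    (∑ i ∈ Finset.range N, ((i : ℝ) + 1) * (D : ℝ)) (hR0 n) (A1 c)
    (fun a => (s a, (fun i : Fin N => p i (a.1 i)), fun i : {i : ℕ // N ≤ i} => a.1 i.1))
    (by
      intro a ha b hb hd
      have h1 := hbig a b _ hd
      have h0 := hsmall a b _ hd le_rfl
      have h2 : s a = s b := hI c.1 (s a) (hs a) (s b) (hs b) _ _ ha.1 hb.1 (h0 _)
      refine Prod.ext h2 (Prod.ext ?_ ?_)
      · funext i
        refine hp1 i _ _ ?_ (h0 i)
        by_cases hi : k ≤ (i : ℕ)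
        · exact hs_eq a b h2 i hi i.2
        · exact (ha.2 ⟨i, not_le.1 hi⟩).trans (hb.2 ⟨i, not_le.1 hi⟩).symm
      · funext i
        exact h1 i.1 i.2)
    (by
      intro a ha b hb h
      obtain ⟨h2, h⟩ := Prod.ext_iff.1 h
      obtain ⟨h3, h4⟩ := Prod.ext_iff.1 h
      refine dRP_le G a.1 b.1 N D (fun i hi => ?_) (fun i hi => congrFun h4 ⟨i, hi⟩)
      refine hp2 i _ _ ?_ (congrFun h3 ⟨i, hi⟩)
      by_cases hik : k ≤ i
      · exact hs_eq a b h2 i hik hi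
      · exact (ha.2 ⟨i, not_le.1 hik⟩).trans (hb.2 ⟨i, not_le.1 hik⟩).symm)
  obtain ⟨U0, hU0, hB0, hC0⟩ := fam0
  choose U1 hU1 hB1 hC1 using fam1
  refine ⟨n, fun j => if h : j - 1 < n then (if j = 0 then U0 else U1 (enc.symm ⟨j - 1, h⟩))
    else U0, ?_, ?_⟩
  · intro j hj
    rcases Nat.eq_zero_or_pos j with rfl | hpos
    · simp only [if_true, dite_eq_ite, ite_self]
      exact ⟨hU0, hB0⟩
    · have h : j - 1 < n := by omega
      simp only [dif_pos h, if_neg hpos.ne']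
      refine ⟨fun A hA B hB hne => ?_, hB1 _⟩
      exact lt_of_le_of_lt (ENNReal.ofReal_le_ofReal (hRm hj)) (hU1 _ A hA B hB hne)
  · intro a
    by_cases ha : a ∈ A0
    · obtain ⟨U, hU, haU⟩ := hC0 a ha
      refine ⟨U, ?_, haU⟩
      simp only [Set.mem_iUnion]
      refine ⟨0, Nat.zero_le _, ?_⟩
      simpa using hU
    · have : ∃ t < k, I t (s a) (a.1 t) := by
        by_contra hc
        push Not at hc
        exact ha hc
      obtain ⟨t, ht, hIt⟩ := this
      obtain ⟨U, hU, haU⟩ := hC1 (⟨t, ht⟩, fun i => e i (a.1 i)) a ⟨hIt, fun i => rfl⟩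
      refine ⟨U, ?_, haU⟩
      simp only [Set.mem_iUnion]
      refine ⟨(enc (⟨t, ht⟩, fun i => e i (a.1 i)) : ℕ) + 1, (enc _).2, ?_⟩
      simpa using hU
end
end

section
/- If a metric space X has weak hyperbolic property C, then the family {X} has straight finite decomposition complexity. -/
open scoped ENNReal
open Filter Set

noncomputable section

theorem whpc_rdisj_mono {X : Type*} {d : X → X → ℝ} {r s : ℝ} (hrs : r ≤ s)
    {F : Set (Set X)} (h : RDisjointD d s F) : RDisjointD d r F :=
  fun A hA B hB hne => lt_of_le_of_lt (ENNReal.ofReal_le_ofReal hrs) (h A hA B hB hne)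

theorem whpc_rdisj_empty {X : Type*} (d : X → X → ℝ) (r : ℝ) :
    RDisjointD d r (∅ : Set (Set X)) := fun A hA => absurd hA (by simp)

theorem whpc_rdisj_single {X : Type*} (d : X → X → ℝ) (r : ℝ) (Z : Set X) :
    RDisjointD d r ({Z} : Set (Set X)) := by
  intro A hA B hB hne
  rw [mem_singleton_iff] at hA hB
  exact absurd (hA.trans hB.symm) hne

/-- peeling off families one at a time -/
theorem whpc_chain {X : Type*} (d : X → X → ℝ) (𝒳 𝒴 : Set (Set X)) (S : ℕ → ℝ) (n : ℕ)
    (F : Set X → ℕ → Set (Set X))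
    (hdis : ∀ Z ∈ 𝒳, ∀ i ≤ n, RDisjointD d (S i) (F Z i))
    (hsub : ∀ Z ∈ 𝒳, ∀ i ≤ n, F Z i ⊆ 𝒴)
    (hcov : ∀ Z ∈ 𝒳, ∀ x ∈ Z, ∃ i ≤ n, ∃ A ∈ F Z i, x ∈ A) :
    ∃ 𝒱 : ℕ → Set (Set X), DecompD d (S 0) 𝒳 (𝒱 0) ∧
      (∀ i < n, DecompD d (S (i + 1)) (𝒱 i) (𝒱 (i + 1))) ∧
      𝒱 n ⊆ 𝒴 ∪ {∅} := by
  let W : Set X → ℕ → Set X := fun Z i => {x | x ∈ Z ∧ ∀ j ≤ i, ∀ A ∈ F Z j, x ∉ A}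
  refine ⟨fun i => {A | ∃ Z ∈ 𝒳, (∃ j ≤ i, A ∈ F Z j) ∨ A = W Z i}, ?_, ?_, ?_⟩
  · intro Z hZ
    refine ⟨F Z 0, {W Z 0}, hdis Z hZ 0 (Nat.zero_le _), whpc_rdisj_single _ _ _, ?_, ?_⟩
    · rintro A (hA | hA)
      · exact ⟨Z, hZ, Or.inl ⟨0, le_rfl, hA⟩⟩
      · exact ⟨Z, hZ, Or.inr hA⟩
    · intro x hx
      by_cases hxA : ∃ A ∈ F Z 0, x ∈ A
      · obtain ⟨A, hA, hxA⟩ := hxA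
        exact ⟨A, Or.inl hA, hxA⟩
      · push Not at hxA
        refine ⟨W Z 0, Or.inr rfl, hx, ?_⟩
        intro j hj
        obtain rfl : j = 0 := by omega
        exact hxA
  · rintro i hi V ⟨Z, hZ, ⟨j, hj, hV⟩ | rfl⟩
    · refine ⟨{V}, ∅, whpc_rdisj_single _ _ _, whpc_rdisj_empty _ _, ?_, ?_⟩
      · rintro A (hA | hA)
        · rw [mem_singleton_iff] at hA
          subst hA
          exact ⟨Z, hZ, Or.inl ⟨j, by omega, hV⟩⟩
        · exact absurd hA (by simp)
      · intro x hx
        exact ⟨V, Or.inl rfl, hx⟩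
    · refine ⟨F Z (i+1), {W Z (i+1)}, hdis Z hZ _ (by omega), whpc_rdisj_single _ _ _, ?_, ?_⟩
      · rintro A (hA | hA)
        · exact ⟨Z, hZ, Or.inl ⟨i+1, le_rfl, hA⟩⟩
        · exact ⟨Z, hZ, Or.inr hA⟩
      · intro x hx
        by_cases hxA : ∃ A ∈ F Z (i+1), x ∈ A
        · obtain ⟨A, hA, hxA⟩ := hxA
          exact ⟨A, Or.inl hA, hxA⟩
        · push Not at hxA
          refine ⟨W Z (i+1), Or.inr rfl, hx.1, ?_⟩
          intro j hj
          rcases Nat.lt_or_ge i j with h | h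
          · obtain rfl : j = i + 1 := by omega
            exact hxA
          · exact hx.2 j h
  · rintro A ⟨Z, hZ, ⟨j, hj, hA⟩ | rfl⟩
    · exact Or.inl (hsub Z hZ j hj hA)
    · right
      rw [mem_singleton_iff, eq_empty_iff_forall_notMem]
      rintro x ⟨hx, hx2⟩
      obtain ⟨i, hi, A, hA, hxA⟩ := hcov Z hZ x hx
      exact hx2 i hi A hA hxA

theorem whpc_cover {X : Type*} [MetricSpace X] {N : ℕ} {R : ℝ} {U : Set X}
    (hU : LSDoubling (fun x y : X => dist x y) N R U) (x : X) (ρ : ℝ) (hρ : 0 < ρ) (k : ℕ)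
    (hk : R ≤ (3/4)^k * ρ) :
    ∃ T : Finset X, T.card ≤ N ^ k ∧
      ∀ y ∈ U, dist x y ≤ ρ → ∃ t ∈ T, dist t y ≤ (3/4)^k * ρ := by
  classical
  induction k with
  | zero => exact ⟨{x}, by simp, fun y _ hy => ⟨x, by simp, by simpa using hy⟩⟩
  | succ k ih =>
    have hpos : 0 < (3/4 : ℝ)^k * ρ := by positivity
    have hle : (3/4 : ℝ)^(k+1) * ρ = 3/4 * ((3/4)^k * ρ) := by ring
    obtain ⟨T, hT, hcov⟩ := ih (by rw [hle] at hk; linarith)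
    choose c hc using fun t : X => hU t _ hk
    refine ⟨T.biUnion fun t => Finset.univ.image (c t), ?_, ?_⟩
    · calc _ ≤ T.card * N := Finset.card_biUnion_le_card_mul _ _ _
            (fun t _ => Finset.card_image_le.trans (by simp))
        _ ≤ N ^ k * N := Nat.mul_le_mul_right _ hT
        _ = _ := (pow_succ _ _).symm
    · intro y hy hxy
      obtain ⟨t, ht, hty⟩ := hcov y hy hxy
      have := hc t (show y ∈ _ from ⟨by
        simp only [mem_setOf_eq]; rw [hle]; linarith, hy⟩)
      simp only [mem_iUnion, mem_setOf_eq] at this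
      obtain ⟨j, hj⟩ := this
      exact ⟨c t j, Finset.mem_biUnion.2 ⟨t, ht, by simp⟩, hj⟩

theorem whpc_maxsep {X : Type*} [MetricSpace X] (L : ℝ) (A : Set X) :
    ∃ S ⊆ A, (∀ p ∈ S, ∀ q ∈ S, p ≠ q → L < dist p q) ∧
      ∀ x ∈ A, x ∉ S → ∃ p ∈ S, dist x p ≤ L := by
  obtain ⟨S, hS⟩ := zorn_subset
    {S : Set X | S ⊆ A ∧ ∀ p ∈ S, ∀ q ∈ S, p ≠ q → L < dist p q} (by
      intro c hc hchain
      refine ⟨⋃₀ c, ⟨?_, ?_⟩, fun s hs => subset_sUnion_of_mem hs⟩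
      · exact sUnion_subset fun s hs => (hc hs).1
      · rintro p ⟨s, hs, hps⟩ q ⟨t, ht, hqt⟩ hne
        rcases hchain.total hs ht with h | h
        · exact (hc ht).2 p (h hps) q hqt hne
        · exact (hc hs).2 p hps q (h hqt) hne)
  refine ⟨S, hS.prop.1, hS.prop.2, ?_⟩
  intro x hx hxS
  by_contra hcon
  push Not at hcon
  apply hxS
  have h2 : insert x S ∈ {S : Set X | S ⊆ A ∧ ∀ p ∈ S, ∀ q ∈ S, p ≠ q → L < dist p q} := by
    refine ⟨insert_subset hx hS.prop.1, ?_⟩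
    rintro p (rfl | hp) q (rfl | hq) hne
    · exact absurd rfl hne
    · exact hcon q hq
    · rw [dist_comm]; exact hcon p hp
    · exact hS.prop.2 p hp q hq hne
  exact hS.le_of_ge h2 (subset_insert x S) (mem_insert x S)

/-- Doubling sets split into boundedly many disjoint bounded families. -/
theorem whpc_asdim {X : Type*} [MetricSpace X] (N : ℕ) (R r : ℝ) :
    ∃ D : ℝ, ∀ U : Set X, LSDoubling (fun x y : X => dist x y) N R U →
      ∃ F : ℕ → Set (Set X), (∀ i, RDisjointD (fun x y : X => dist x y) r (F i)) ∧
        (∀ i, MeshLE (fun x y : X => dist x y) D (F i)) ∧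
        ∀ x ∈ U, ∃ i ≤ N ^ 8, ∃ A ∈ F i, x ∈ A := by
  classical
  obtain ⟨s, hs1, hsR, hsr⟩ : ∃ s : ℝ, 1 ≤ s ∧ 4 * R ≤ s ∧ r ≤ s :=
    ⟨max 1 (max (4*R) r), by simp, by simp, by simp⟩
  refine ⟨2 * s, fun U hU => ?_⟩
  choose S hSA hSsep hSmax using fun A : Set X => whpc_maxsep (4 * s) A
  let W : ℕ → Set X := fun i =>
    Nat.rec U (fun _ A => A \ {x | ∃ p ∈ S A, dist p x ≤ s}) i
  have hW : ∀ i, W (i+1) = W i \ {x | ∃ p ∈ S (W i), dist p x ≤ s} := fun i => rfl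
  have hanti : Antitone W := antitone_nat_of_succ_le fun i => by
    rw [hW]; exact diff_subset
  refine ⟨fun i => {A | ∃ p ∈ S (W i), A = Metric.closedBall p s}, ?_, ?_, ?_⟩
  · rintro i A ⟨p, hp, rfl⟩ B ⟨q, hq, rfl⟩ hne
    have hpq : p ≠ q := fun h => hne (by rw [h])
    have h4 := hSsep _ p hp q hq hpq
    refine lt_of_lt_of_le ((ENNReal.ofReal_lt_ofReal_iff (q := 2 * s) (by linarith)).2
      (by linarith)) ?_
    refine le_iInf₂ fun a ha => le_iInf₂ fun b hb => ENNReal.ofReal_le_ofReal ?_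
    have h1 := dist_triangle4 p a b q
    rw [Metric.mem_closedBall] at ha hb
    rw [dist_comm p a] at h1
    linarith
  · rintro i A ⟨p, hp, rfl⟩ x hx y hy
    rw [Metric.mem_closedBall] at hx hy
    have := dist_triangle_right x y p
    show dist x y ≤ 2 * s
    linarith
  · intro x hx
    by_contra hcon
    have hxn : ∀ i ≤ N ^ 8, ∀ p ∈ S (W i), s < dist p x := by
      intro i hi p hp
      by_contra h
      exact hcon ⟨i, hi, _, ⟨p, hp, rfl⟩, by
        rw [Metric.mem_closedBall, dist_comm]; linarith⟩
    have hxW : ∀ i ≤ N ^ 8, x ∈ W i := by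
      intro i
      induction i with
      | zero => intro _; exact hx
      | succ i ih =>
        intro hi
        rw [hW]
        refine ⟨ih (by omega), ?_⟩
        rintro ⟨p, hp, hpx⟩
        have := hxn i (by omega) p hp
        linarith
    have hq : ∀ i, ∃ q, i ≤ N ^ 8 → q ∈ S (W i) ∧ dist x q ≤ 4 * s := by
      intro i
      by_cases hi : i ≤ N ^ 8
      · obtain ⟨q, hq⟩ := hSmax (W i) x (hxW i hi) (fun h => by
          have := hxn i hi x h
          rw [dist_self] at this
          linarith)
        exact ⟨q, fun _ => hq⟩
      · exact ⟨x, fun h => absurd h hi⟩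
    choose q hq using hq
    have hsep : ∀ i j, i < j → j ≤ N ^ 8 → s < dist (q i) (q j) := by
      intro i j hij hj
      have h1 : q j ∈ W (i+1) := hanti hij (hSA _ (hq j hj).1)
      rw [hW] at h1
      by_contra h
      exact h1.2 ⟨q i, (hq i (by omega)).1, by linarith⟩
    obtain ⟨T, hT, hcov⟩ := whpc_cover hU x (4 * s) (by linarith) 8 (by norm_num; linarith)
    have hqU : ∀ i ≤ N ^ 8, q i ∈ U := fun i hi =>
      hanti (Nat.zero_le i) (hSA _ (hq i hi).1)
    have ht : ∀ i, ∃ t, i ≤ N ^ 8 → t ∈ T ∧ dist t (q i) ≤ (3/4)^8 * (4 * s) := by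
      intro i
      by_cases hi : i ≤ N ^ 8
      · obtain ⟨t, ht⟩ := hcov (q i) (hqU i hi) (hq i hi).2
        exact ⟨t, fun _ => ht⟩
      · exact ⟨x, fun h => absurd h hi⟩
    choose t ht using ht
    obtain ⟨i, hi, j, hj, hij, hEq⟩ := Finset.exists_ne_map_eq_of_card_lt_of_maps_to
      (s := Finset.range (N ^ 8 + 1)) (t := T) (f := t)
      (by rw [Finset.card_range]; omega)
      (fun i hi => (ht i (by simpa [Nat.lt_succ_iff] using hi)).1)
    rw [Finset.mem_range, Nat.lt_succ_iff] at hi hj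
    have h1 := (ht i hi).2
    have h2 := (ht j hj).2
    rw [← hEq] at h2
    have h3 := dist_triangle_left (q i) (q j) (t i)
    norm_num at h1 h2
    rcases lt_or_gt_of_ne hij with h | h
    · have := hsep i j h hj
      linarith
    · have := hsep j i h hi
      rw [dist_comm] at this
      linarith

/-- a metric space with weak hyperbolic property C has
straight finite decomposition complexity. -/
theorem whpc_sfdc {X : Type*} [MetricSpace X]
    (h : WHPCD (fun x y : X => dist x y)) :
    SFDCD (fun x y : X => dist x y) {Set.univ} := by
  intro R hR hmono
  obtain ⟨n, 𝒰, hdis, hcov, N, R₀, hdoub⟩ := h R hR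
  obtain ⟨𝒱, hV0, hV1, hVn⟩ := whpc_chain (fun x y : X => dist x y) {Set.univ}
    (⋃ i ≤ n, 𝒰 i) R n (fun _ i => 𝒰 i) (fun _ _ i hi => hdis i hi)
    (fun _ _ i hi => subset_iUnion₂_of_subset i hi subset_rfl)
    (by
      intro Z _ x _
      obtain ⟨A, hA, hxA⟩ := hcov x
      simp only [mem_iUnion] at hA
      obtain ⟨i, hi, hA⟩ := hA
      exact ⟨i, hi, A, hA, hxA⟩)
  have hVd : ∀ Z ∈ 𝒱 n, LSDoubling (fun x y : X => dist x y) N R₀ Z := by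
    intro Z hZ
    rcases hVn hZ with hZ | hZ
    · exact hdoub Z hZ
    · rw [mem_singleton_iff] at hZ
      subst hZ
      exact fun x r _ => ⟨fun _ => x, by simp⟩
  obtain ⟨D, hD⟩ := whpc_asdim (X := X) N R₀ (R (n + 1 + N ^ 8))
  have hF : ∀ Z : Set X, ∃ F : ℕ → Set (Set X), Z ∈ 𝒱 n →
      (∀ i, RDisjointD (fun x y : X => dist x y) (R (n + 1 + N ^ 8)) (F i)) ∧
        (∀ i, MeshLE (fun x y : X => dist x y) D (F i)) ∧
        ∀ x ∈ Z, ∃ i ≤ N ^ 8, ∃ A ∈ F i, x ∈ A := by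
    intro Z
    by_cases hZ : Z ∈ 𝒱 n
    · obtain ⟨F, hF⟩ := hD Z (hVd Z hZ)
      exact ⟨F, fun _ => hF⟩
    · exact ⟨fun _ => ∅, fun h => absurd h hZ⟩
  choose F hF using hF
  obtain ⟨𝒱', hV0', hV1', hVn'⟩ := whpc_chain (fun x y : X => dist x y) (𝒱 n)
    {A | ∀ x ∈ A, ∀ y ∈ A, dist x y ≤ D} (fun i => R (n + 1 + i)) (N ^ 8) F
    (fun Z hZ i hi => whpc_rdisj_mono (hmono (by omega)) ((hF Z hZ).1 i))
    (fun Z hZ i _ A hA => (hF Z hZ).2.1 i A hA)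
    (fun Z hZ => (hF Z hZ).2.2)
  refine ⟨n + 1 + N ^ 8, fun i => if i ≤ n then 𝒱 i else 𝒱' (i - (n + 1)), ?_, ?_, D, ?_⟩
  · simpa using hV0
  · intro i hi
    rcases lt_trichotomy i n with hlt | rfl | hgt
    · simp only [if_pos hlt.le, if_pos (show i + 1 ≤ n from hlt)]
      exact hV1 i hlt
    · simpa using hV0'
    · obtain ⟨k, rfl⟩ := Nat.exists_eq_add_of_le (show n + 1 ≤ i from hgt)
      have e1 : n + 1 + k + 1 - (n + 1) = k + 1 := by omega
      have e2 : n + 1 + k - (n + 1) = k := by omega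
      simp only [if_neg (show ¬ (n + 1 + k ≤ n) by omega),
        if_neg (show ¬ (n + 1 + k + 1 ≤ n) by omega), e1, e2]
      exact hV1' k (by omega)
  · have e2 : n + 1 + N ^ 8 - (n + 1) = N ^ 8 := by omega
    simp only [if_neg (show ¬ (n + 1 + N ^ 8 ≤ n) by omega), e2]
    intro A hA
    rcases hVn' hA with hA | hA
    · exact hA
    · rw [mem_singleton_iff] at hA
      subst hA
      simp
end
end
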